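/- Let f₁, f₂ : ℝⁿ → ℝ be CPWL functions, both with minimal depth m₁, such that f₁ + f₂ has minimal depth m with m < m₁. Then for any CPWL function g : ℝⁿ → ℝ, the function g + f₂ has minimal depth m₁ if and only if g − f₁ has minimal depth m₁. -/

import Mathlib

open Pointwise

noncomputable section

/-- `NN m n` is the set of functions `ℝⁿ → ℝ` representable by a ReLU neural network
with `m` hidden layers: `f = T⁽ᵐ⁺¹⁾ ∘ σ ∘ T⁽ᵐ⁾ ∘ σ ∘ ⋯ ∘ σ ∘ T⁽¹⁾` with each `T⁽ˡ⁾` affine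
and `σ` the componentwise ReLU.  (`NN 0 n` is the set of affine functions.) -/
def NN : ℕ → (n : ℕ) → Set ((Fin n → ℝ) → ℝ)
  | 0, n => {f | ∃ T : (Fin n → ℝ) →ᵃ[ℝ] ℝ, f = ⇑T}
  | m + 1, n => {f | ∃ (w : ℕ) (T : (Fin n → ℝ) →ᵃ[ℝ] (Fin w → ℝ)),
      ∃ g ∈ NN m w, f = fun x => g fun i => max (T x i) 0}

/-- Continuous piecewise linear functions `ℝⁿ → ℝ`: continuous functions that at each point
agree with one of finitely many affine functions. -/
def CPWL (n : ℕ) : Set ((Fin n → ℝ) → ℝ) :=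
  {f | Continuous f ∧ ∃ s : Finset ((Fin n → ℝ) →ᵃ[ℝ] ℝ), ∀ x, ∃ g ∈ s, f x = g x}

/-- `f` has minimal depth `m`: `f ∈ Υₙ(m)` and either `m = 0` or `f ∉ Υₙ(m-1)`. -/
def MinDepth (n : ℕ) (f : (Fin n → ℝ) → ℝ) (m : ℕ) : Prop :=
  f ∈ NN m n ∧ (m = 0 ∨ f ∉ NN (m - 1) n)

/-- `Mn n` is the least `m` such that `Υₙ = Υₙ(m)`. -/
def Mn (n : ℕ) : ℕ := sInf {m | CPWL n = NN m n}

theorem NN.comp_affine {m k n : ℕ} {f : (Fin k → ℝ) → ℝ} (hf : f ∈ NN m k)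
    (A : (Fin n → ℝ) →ᵃ[ℝ] (Fin k → ℝ)) : (fun x => f (A x)) ∈ NN m n := by
  cases m with
  | zero =>
    obtain ⟨T, rfl⟩ := hf
    exact ⟨T.comp A, rfl⟩
  | succ m =>
    obtain ⟨w, T, g, hg, rfl⟩ := hf
    exact ⟨w, T.comp A, g, hg, rfl⟩

theorem NN.neg {m n : ℕ} {f : (Fin n → ℝ) → ℝ} (hf : f ∈ NN m n) : -f ∈ NN m n := by
  induction m generalizing n with
  | zero =>
    obtain ⟨T, rfl⟩ := hf
    exact ⟨-T, rfl⟩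
  | succ m ih =>
    obtain ⟨w, T, g, hg, rfl⟩ := hf
    exact ⟨w, T, -g, ih hg, rfl⟩

theorem NN.add {m n : ℕ} {f g : (Fin n → ℝ) → ℝ} (hf : f ∈ NN m n) (hg : g ∈ NN m n) :
    f + g ∈ NN m n := by
  induction m generalizing n with
  | zero =>
    obtain ⟨S, rfl⟩ := hf
    obtain ⟨T, rfl⟩ := hg
    exact ⟨S + T, rfl⟩
  | succ m ih =>
    obtain ⟨v, S, p, hp, rfl⟩ := hf
    obtain ⟨w, T, q, hq, rfl⟩ := hg
    refine ⟨v + w, AffineMap.pi (Fin.addCases (fun i => (AffineMap.proj i).comp S)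
      (fun j => (AffineMap.proj j).comp T)), _,
      ih (NN.comp_affine hp (LinearMap.funLeft ℝ ℝ (Fin.castAdd w)).toAffineMap)
        (NN.comp_affine hq (LinearMap.funLeft ℝ ℝ (Fin.natAdd v)).toAffineMap), ?_⟩
    funext x
    simp [LinearMap.funLeft, Function.comp_def]

theorem NN.sub {m n : ℕ} {f g : (Fin n → ℝ) → ℝ} (hf : f ∈ NN m n) (hg : g ∈ NN m n) :
    f - g ∈ NN m n :=
  sub_eq_add_neg f g ▸ NN.add hf (NN.neg hg)

theorem NN.subset_succ (m n : ℕ) : NN m n ⊆ NN (m + 1) n := by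
  induction m generalizing n with
  | zero =>
    rintro _ ⟨T, rfl⟩
    refine ⟨2, AffineMap.pi ![T, -T], _,
      ⟨((LinearMap.proj 0 : (Fin 2 → ℝ) →ₗ[ℝ] ℝ) - LinearMap.proj 1).toAffineMap, rfl⟩, ?_⟩
    funext x
    simp
  | succ m ih =>
    rintro _ ⟨w, T, g, hg, rfl⟩
    exact ⟨w, T, g, ih w hg, rfl⟩

theorem NN.mono (n : ℕ) : Monotone fun m => NN m n :=
  monotone_nat_of_le_succ fun m => NN.subset_succ m n

/-- Adding a function of depth `k` does not affect membership in `NN m n` for `k ≤ m`. -/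
theorem NN.add_mem_iff {k m n : ℕ} (hkm : k ≤ m) {f h : (Fin n → ℝ) → ℝ} (hh : h ∈ NN k n) :
    f + h ∈ NN m n ↔ f ∈ NN m n := by
  have hh' : h ∈ NN m n := NN.mono n hkm hh
  exact ⟨fun hf => add_sub_cancel_right f h ▸ NN.sub hf hh', fun hf => NN.add hf hh'⟩

/-- Adding a function of depth `k < m` does not affect having minimal depth `m`. -/
theorem MinDepth.add_iff {k m n : ℕ} (hkm : k < m) {f h : (Fin n → ℝ) → ℝ} (hh : h ∈ NN k n) :
    MinDepth n (f + h) m ↔ MinDepth n f m := by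
  rw [MinDepth, MinDepth, NN.add_mem_iff hkm.le hh, NN.add_mem_iff (Nat.le_sub_one_of_lt hkm) hh]

/-- If `f₁, f₂` are CPWL, both of minimal depth `m₁`, and `f₁ + f₂` has minimal
depth `m < m₁`, then for any CPWL `g`, `g + f₂` has minimal depth `m₁` iff `g - f₁` has
minimal depth `m₁`. -/
theorem statement5 (n m m₁ : ℕ) (f₁ f₂ : (Fin n → ℝ) → ℝ)
    (h₁ : f₁ ∈ CPWL n) (h₂ : f₂ ∈ CPWL n)
    (hm₁ : MinDepth n f₁ m₁) (hm₂ : MinDepth n f₂ m₁)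
    (hsum : MinDepth n (f₁ + f₂) m) (hlt : m < m₁)
    (g : (Fin n → ℝ) → ℝ) (hg : g ∈ CPWL n) :
    MinDepth n (g + f₂) m₁ ↔ MinDepth n (g - f₁) m₁ := by
  rw [show g + f₂ = (g - f₁) + (f₁ + f₂) by abel]
  exact MinDepth.add_iff hlt hsum.1
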